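/- Every J-stable ring has stable range 2, i.e., whenever a₁, a₂, a₃ ∈ R satisfy a₁R + a₂R + a₃R = R, there exist y₁, y₂ ∈ R such that (a₁ + a₃y₁)R + (a₂ + a₃y₂)R = R. -/

import Mathlib

/-- A commutative ring has stable range 1 if whenever `aR + bR = R`,
there exists `y` such that `a + b * y` is a unit. -/
def StableRange1 (R : Type*) [CommRing R] : Prop :=
  ∀ a b : R, Ideal.span {a} ⊔ Ideal.span {b} = ⊤ → ∃ y : R, IsUnit (a + b * y)

/-- A commutative ring is J-stable if `R/aR` has stable range 1 for every
`a` not in the Jacobson radical. -/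
def JStable (R : Type*) [CommRing R] : Prop :=
  ∀ a : R, a ∉ Ideal.jacobson (⊥ : Ideal R) → StableRange1 (R ⧸ Ideal.span {a})

theorem Ideal.span_singleton_sup_span_singleton_eq_top_iff {R : Type*} [CommRing R] (a b : R) :
    Ideal.span {a} ⊔ Ideal.span {b} = ⊤ ↔ IsCoprime a b := by
  rw [← Ideal.isCoprime_iff_sup_eq, Ideal.isCoprime_span_singleton_iff]

theorem Ideal.isUnit_mk_span_singleton_iff {R : Type*} [CommRing R] (a b : R) :
    IsUnit (Ideal.Quotient.mk (Ideal.span {a}) b) ↔ IsCoprime a b := by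
  rw [isUnit_iff_exists_inv]
  constructor
  · rintro ⟨c, hc⟩
    obtain ⟨c, rfl⟩ := Ideal.Quotient.mk_surjective c
    rw [← map_mul, ← map_one (Ideal.Quotient.mk _), Ideal.Quotient.mk_eq_mk_iff_sub_mem,
      Ideal.mem_span_singleton] at hc
    obtain ⟨d, hd⟩ := hc
    exact ⟨-d, c, by linear_combination hd⟩
  · rintro ⟨d, c, h⟩
    refine ⟨Ideal.Quotient.mk _ c, ?_⟩
    rw [← map_mul, ← map_one (Ideal.Quotient.mk _), Ideal.Quotient.mk_eq_mk_iff_sub_mem,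
      Ideal.mem_span_singleton]
    exact ⟨-d, by linear_combination h⟩

/-- If `a` lies outside the Jacobson radical of a J-stable ring, a unimodular triple `(a, b, c)`
can be shortened without changing `a`. -/
theorem JStable.exists_isCoprime_add_mul {R : Type*} [CommRing R] (h : JStable R) {a b c : R}
    (ha : a ∉ Ideal.jacobson (⊥ : Ideal R)) (habc : ∃ u v w : R, a * u + b * v + c * w = 1) :
    ∃ y : R, IsCoprime a (b + c * y) := by
  obtain ⟨u, v, w, huvw⟩ := habc
  let f := Ideal.Quotient.mk (Ideal.span {a})
  have hfa : f a = 0 := Ideal.Quotient.eq_zero_iff_mem.2 (Ideal.mem_span_singleton_self a)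
  have hbc : IsCoprime (f b) (f c) := by
    have huvw' := congrArg f huvw
    simp only [map_add, map_mul, map_one, hfa] at huvw'
    exact ⟨f v, f w, by linear_combination huvw'⟩
  obtain ⟨y, hy⟩ :=
    h a ha _ _ ((Ideal.span_singleton_sup_span_singleton_eq_top_iff _ _).2 hbc)
  obtain ⟨y, rfl⟩ := Ideal.Quotient.mk_surjective y
  refine ⟨y, (Ideal.isUnit_mk_span_singleton_iff _ _).1 ?_⟩
  rwa [map_add, map_mul]

theorem jstable_stableRange2 (R : Type*) [CommRing R] (h : JStable R) :
    ∀ a₁ a₂ a₃ : R,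
      Ideal.span {a₁} ⊔ Ideal.span {a₂} ⊔ Ideal.span {a₃} = ⊤ →
      ∃ y₁ y₂ : R,
        Ideal.span {a₁ + a₃ * y₁} ⊔ Ideal.span {a₂ + a₃ * y₂} = ⊤ := by
  intro a b c habc
  simp only [Ideal.span_singleton_sup_span_singleton_eq_top_iff]
  obtain ⟨u, v, w, huvw⟩ : ∃ u v w : R, a * u + b * v + c * w = 1 := by
    have h1 : (1 : R) ∈ Ideal.span {a} ⊔ Ideal.span {b} ⊔ Ideal.span {c} := by
      rw [habc]; trivial
    obtain ⟨x, hx, z, hz, hxz⟩ := Submodule.mem_sup.1 h1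
    obtain ⟨x₁, hx₁, x₂, hx₂, rfl⟩ := Submodule.mem_sup.1 hx
    obtain ⟨u, rfl⟩ := Ideal.mem_span_singleton.1 hx₁
    obtain ⟨v, rfl⟩ := Ideal.mem_span_singleton.1 hx₂
    obtain ⟨w, rfl⟩ := Ideal.mem_span_singleton.1 hz
    exact ⟨u, v, w, hxz⟩
  by_cases ha : a ∈ Ideal.jacobson (⊥ : Ideal R)
  · by_cases hb : b ∈ Ideal.jacobson (⊥ : Ideal R)
    · have hab : a * u + b * v ∈ Ideal.jacobson (⊥ : Ideal R) :=
        add_mem (Ideal.mul_mem_right _ _ ha) (Ideal.mul_mem_right _ _ hb)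
      have hcw : IsUnit (c * w) := by
        have hunit := Ideal.mem_jacobson_bot.1 hab (-1)
        rwa [show (a * u + b * v) * -1 + 1 = c * w by linear_combination -huvw] at hunit
      obtain ⟨d, hd⟩ := isUnit_iff_exists_inv.1 hcw
      exact ⟨w * d * (1 - a), 0, 1, 0, by linear_combination (1 - a) * hd⟩
    · obtain ⟨y, hy⟩ := h.exists_isCoprime_add_mul (b := a) (c := c) hb
        ⟨v, u, w, by linear_combination huvw⟩
      exact ⟨y, 0, by simpa using hy.symm⟩
  · obtain ⟨y, hy⟩ := h.exists_isCoprime_add_mul ha ⟨u, v, w, huvw⟩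
    exact ⟨0, y, by simpa using hy⟩
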